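/- Let K, P > 0, and put h(κ,p) = exp(−κ²/K² − p²/P²) for κ ∈ ℝ, p ∈ ℤ. For x > 0, φ ∈ ℝ, κ ∈ ℝ and p ∈ ℤ, define 𝐉_{iκ,p}(x·e^{iφ}) = 4π·i^{2p} ∫_ℝ (conj(w_r)/|w_r|)^{2p} · J_{2p}(2x·|w_r|) · exp(2irκ) dr, where w_r = cosh(r+iφ) (the integrand is set to 0 at the measure-zero set where w_r = 0). Then ∫_ℝ Σ_{p∈ℤ} h(κ,p)·𝐉_{iκ,p}(x·e^{iφ})·(κ² + p²) dκ = −∫_ℝ ∫₀^π cos(2·Re(x·e^{iφ}·trh(r,ω)))·(k''(r)·θ(ω) + k(r)·θ''(ω)) dω dr. -/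

import Mathlib

open scoped Real ComplexConjugate Classical
open Complex

/-- `J_{2p}(x) = (1/(2π i^{2p})) ∫₀^{2π} exp(2ipω + i x cos ω) dω`. -/
noncomputable def besselJ (p : ℤ) (x : ℝ) : ℂ :=
  (1 / (2 * Real.pi * Complex.I ^ (2 * p))) *
    ∫ ω in (0:ℝ)..(2 * Real.pi),
      Complex.exp (2 * Complex.I * (p : ℂ) * (ω : ℂ) + Complex.I * (x : ℂ) * (Real.cos ω : ℂ))

/-- `trh(r,ω) = cosh r cos ω + i sinh r sin ω`. -/
noncomputable def trh (r ω : ℝ) : ℂ :=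
  (Real.cosh r * Real.cos ω : ℝ) + Complex.I * (Real.sinh r * Real.sin ω : ℝ)

/-- `k(r) = √π K exp(−K²r²)`. -/
noncomputable def kfun (K r : ℝ) : ℝ := Real.sqrt Real.pi * K * Real.exp (-(K ^ 2 * r ^ 2))

/-- `θ(ω) = √π P Σ_{q∈ℤ} exp(−P²(ω+πq)²)`. -/
noncomputable def thetafun (P ω : ℝ) : ℝ :=
  Real.sqrt Real.pi * P * ∑' q : ℤ, Real.exp (-(P ^ 2 * (ω + Real.pi * q) ^ 2))

/-- The Bessel function `𝐉_{iκ,p}(x e^{iφ})`, given by the integral representation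
`4π i^{2p} ∫_ℝ (conj w_r/|w_r|)^{2p} J_{2p}(2x|w_r|) e^{2irκ} dr` with `w_r = cosh(r+iφ)`,
the integrand being `0` where `w_r = 0`. -/
noncomputable def Jbold (x φ κ : ℝ) (p : ℤ) : ℂ :=
  4 * Real.pi * Complex.I ^ (2 * p) *
    ∫ r : ℝ,
      if Complex.cosh ((r : ℂ) + Complex.I * (φ : ℂ)) = 0 then 0
      else
        (conj (Complex.cosh ((r : ℂ) + Complex.I * (φ : ℂ))) /
            (‖Complex.cosh ((r : ℂ) + Complex.I * (φ : ℂ))‖ : ℂ)) ^ (2 * p) *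
          besselJ p (2 * x * ‖Complex.cosh ((r : ℂ) + Complex.I * (φ : ℂ))‖) *
          Complex.exp (2 * Complex.I * (r : ℂ) * (κ : ℂ))

lemma sumG {P : ℝ} (hP : 0 < P) (k : ℕ) :
    Summable fun n : ℤ => |(n : ℝ)| ^ k * Real.exp (-((n : ℝ) / P) ^ 2) := by
  have h := summable_pow_mul_jacobiTheta₂_term_bound 0 (T := 1 / (π * P ^ 2)) (by positivity) k
  refine h.congr fun n => ?_
  push_cast
  congr 2
  have := Real.pi_ne_zero
  field_simp
  ring

lemma intG {K : ℝ} (hK : 0 < K) (k : ℕ) :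
    MeasureTheory.Integrable fun κ : ℝ => |κ| ^ k * Real.exp (-(κ / K) ^ 2) := by
  have h := (integrable_rpow_mul_exp_neg_mul_sq (b := 1 / K ^ 2) (by positivity)
    (s := k) (by have : (0:ℝ) ≤ k := Nat.cast_nonneg k
                 linarith)).norm
  refine h.congr (Filter.Eventually.of_forall fun κ => ?_)
  simp only [Real.rpow_natCast, norm_mul, norm_pow, Real.norm_eq_abs, Real.abs_exp]
  congr 2
  field_simp

lemma realDeriv {f : ℝ → ℝ} {F' : ℂ} {t : ℝ} (h : HasDerivAt (fun s => (f s : ℂ)) F' t) :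
    ((deriv f t : ℝ) : ℂ) = F' := by
  have h1 : HasDerivAt f F'.re t := by
    have := Complex.reCLM.hasFDerivAt.comp_hasDerivAt t h
    simpa [Function.comp_def] using this
  rw [h1.deriv]
  exact h1.ofReal_comp.unique h

lemma expDeriv (a : ℂ) (n : ℕ) (c : ℝ) (y : ℝ) :
    HasDerivAt (fun s : ℝ => a * (c : ℂ) ^ n * cexp (2 * I * (c : ℂ) * (s : ℂ)))
      ((2 * I) * (a * (c : ℂ) ^ (n + 1) * cexp (2 * I * (c : ℂ) * (y : ℂ)))) y := by
  have h1 : HasDerivAt (fun s : ℝ => 2 * I * (c : ℂ) * (s : ℂ)) (2 * I * (c : ℂ) * 1) y :=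
    (HasDerivAt.ofReal_comp (hasDerivAt_id y)).const_mul _
  refine (h1.cexp.const_mul _).congr_deriv ?_
  ring

lemma normE (c s : ℝ) : ‖cexp (2 * I * (c : ℂ) * (s : ℂ))‖ = 1 := by
  rw [show 2 * I * (c : ℂ) * (s : ℂ) = ((2 * c * s : ℝ) : ℂ) * I by push_cast; ring]
  exact norm_exp_ofReal_mul_I _

lemma theta_eq {P : ℝ} (hP : 0 < P) (ω : ℝ) : ((thetafun P ω : ℝ) : ℂ) =
    ∑' p : ℤ, ((Real.exp (-((p : ℝ) / P) ^ 2) : ℝ) : ℂ) * (((p : ℝ) : ℂ)) ^ 0 *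
      cexp (2 * I * ((p : ℝ) : ℂ) * (ω : ℂ)) := by
  have hpi := Real.pi_ne_zero
  have hpi' : (π : ℂ) ≠ 0 := by exact_mod_cast hpi
  have hP' : (P : ℂ) ≠ 0 := by exact_mod_cast hP.ne'
  have h := Complex.tsum_exp_neg_quadratic (a := ((1 / (π * P ^ 2) : ℝ) : ℂ))
    (by rw [ofReal_re]; positivity) (I * ω / π)
  have e1 : (∑' p : ℤ, ((Real.exp (-((p : ℝ) / P) ^ 2) : ℝ) : ℂ) * (((p : ℝ) : ℂ)) ^ 0 *
      cexp (2 * I * ((p : ℝ) : ℂ) * (ω : ℂ))) = ∑' n : ℤ,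
      cexp (-π * ((1 / (π * P ^ 2) : ℝ) : ℂ) * n ^ 2 + 2 * π * (I * ω / π) * n) := by
    refine tsum_congr fun n => ?_
    rw [pow_zero, mul_one, ofReal_exp, ← Complex.exp_add]
    congr 1
    push_cast
    field_simp
  rw [e1, h]
  unfold thetafun
  rw [ofReal_mul, ofReal_tsum]
  congr 1
  · have : (((1 / (π * P ^ 2) : ℝ) : ℂ)) ^ (1 / 2 : ℂ) = ((1 / (√π * P) : ℝ) : ℂ) := by
      rw [show (1 / 2 : ℂ) = ((1 / 2 : ℝ) : ℂ) by push_cast; rfl,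
        ← ofReal_cpow (by positivity), ← Real.sqrt_eq_rpow]
      congr 1
      rw [Real.sqrt_div (by norm_num), Real.sqrt_mul (by positivity), Real.sqrt_sq hP.le,
        Real.sqrt_one]
    rw [this]
    push_cast
    rw [one_div_one_div]
  · rw [← (Equiv.neg ℤ).tsum_eq]
    refine tsum_congr fun n => ?_
    rw [ofReal_exp]
    congr 1
    simp only [Equiv.neg_apply]
    push_cast
    have : I * (I * (ω : ℂ) / π) = - ω / π := by
      rw [← mul_div_assoc, ← mul_assoc, I_mul_I]; ring
    rw [this]
    field_simp
    ring

lemma sumE {P : ℝ} (hP : 0 < P) (k : ℕ) (ω : ℝ) :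
    Summable fun p : ℤ => ((Real.exp (-((p : ℝ) / P) ^ 2) : ℝ) : ℂ) * (((p : ℝ) : ℂ)) ^ k *
      cexp (2 * I * ((p : ℝ) : ℂ) * (ω : ℂ)) := by
  refine Summable.of_norm_bounded (sumG hP k) fun n => le_of_eq ?_
  rw [norm_mul, normE, norm_mul, norm_pow, norm_real, norm_real, Real.norm_eq_abs,
    Real.norm_eq_abs, Real.abs_exp]
  ring

lemma sumDeriv {P : ℝ} (hP : 0 < P) (k : ℕ) (ω : ℝ) :
    HasDerivAt (fun s : ℝ => ∑' p : ℤ, ((Real.exp (-((p : ℝ) / P) ^ 2) : ℝ) : ℂ) *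
      (((p : ℝ) : ℂ)) ^ k * cexp (2 * I * ((p : ℝ) : ℂ) * (s : ℂ)))
    ((2 * I) * ∑' p : ℤ, ((Real.exp (-((p : ℝ) / P) ^ 2) : ℝ) : ℂ) *
      (((p : ℝ) : ℂ)) ^ (k + 1) * cexp (2 * I * ((p : ℝ) : ℂ) * (ω : ℂ))) ω := by
  rw [← tsum_mul_left]
  refine hasDerivAt_tsum ((sumG hP (k + 1)).mul_left 2) (fun n y => expDeriv _ k n y)
    (fun n y => le_of_eq ?_) (sumE hP k 0) ω
  rw [norm_mul, norm_mul, norm_mul, normE, norm_mul, norm_pow, norm_real, norm_real,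
    Real.norm_eq_abs, Real.norm_eq_abs, Real.abs_exp]
  simp
  ring

lemma theta_dd {P : ℝ} (hP : 0 < P) (ω : ℝ) : ((deriv (deriv (thetafun P)) ω : ℝ) : ℂ) =
    -4 * ∑' p : ℤ, ((Real.exp (-((p : ℝ) / P) ^ 2) : ℝ) : ℂ) * (((p : ℝ) : ℂ)) ^ 2 *
      cexp (2 * I * ((p : ℝ) : ℂ) * (ω : ℂ)) := by
  have h1 : ∀ t, ((deriv (thetafun P) t : ℝ) : ℂ) = _ := fun t => realDeriv
    ((sumDeriv hP 0 t).congr_of_eventuallyEq (Filter.Eventually.of_forall (theta_eq hP)))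
  have h2 := realDeriv (((sumDeriv hP 1 ω).const_mul (2 * I)).congr_of_eventuallyEq
    (Filter.Eventually.of_forall h1))
  rw [h2, ← mul_assoc]
  congr 1
  linear_combination 4 * I_mul_I

lemma intE {K : ℝ} (hK : 0 < K) (k : ℕ) (r : ℝ) :
    MeasureTheory.Integrable fun κ : ℝ => ((Real.exp (-(κ / K) ^ 2) : ℝ) : ℂ) * (κ : ℂ) ^ k *
      cexp (2 * I * (κ : ℂ) * (r : ℂ)) := by
  refine (intG hK k).mono' (by fun_prop) (Filter.Eventually.of_forall fun κ => le_of_eq ?_)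
  rw [norm_mul, normE, norm_mul, norm_pow, norm_real, norm_real, Real.norm_eq_abs,
    Real.norm_eq_abs, Real.abs_exp]
  ring

lemma intDeriv {K : ℝ} (hK : 0 < K) (k : ℕ) (r : ℝ) :
    HasDerivAt (fun s : ℝ => ∫ κ : ℝ, ((Real.exp (-(κ / K) ^ 2) : ℝ) : ℂ) *
      (κ : ℂ) ^ k * cexp (2 * I * (κ : ℂ) * (s : ℂ)))
    ((2 * I) * ∫ κ : ℝ, ((Real.exp (-(κ / K) ^ 2) : ℝ) : ℂ) *
      (κ : ℂ) ^ (k + 1) * cexp (2 * I * (κ : ℂ) * (r : ℂ))) r := by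
  rw [← MeasureTheory.integral_const_mul]
  refine (hasDerivAt_integral_of_dominated_loc_of_deriv_le (𝕜 := ℝ) (s := Set.univ)
    (F := fun s κ => ((Real.exp (-(κ / K) ^ 2) : ℝ) : ℂ) *
      (κ : ℂ) ^ k * cexp (2 * I * (κ : ℂ) * (s : ℂ)))
    (bound := fun κ => 2 * (|κ| ^ (k + 1) * Real.exp (-(κ / K) ^ 2)))
    Filter.univ_mem (Filter.Eventually.of_forall fun s => ?_) (intE hK k r) (F' := fun s κ =>
      (2 * I) * (((Real.exp (-(κ / K) ^ 2) : ℝ) : ℂ) *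
      (κ : ℂ) ^ (k + 1) * cexp (2 * I * (κ : ℂ) * (s : ℂ)))) ?_
    (Filter.Eventually.of_forall fun κ s _ => le_of_eq ?_) ((intG hK (k + 1)).const_mul 2)
    (Filter.Eventually.of_forall fun κ s _ => expDeriv _ k κ s)).2
  · fun_prop
  · fun_prop
  · rw [norm_mul, norm_mul, norm_mul, normE, norm_mul, norm_pow, norm_real, norm_real,
      Real.norm_eq_abs, Real.norm_eq_abs, Real.abs_exp]
    simp
    ring

lemma k_eq {K : ℝ} (hK : 0 < K) (r : ℝ) : ((kfun K r : ℝ) : ℂ) =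
    ∫ κ : ℝ, ((Real.exp (-(κ / K) ^ 2) : ℝ) : ℂ) * (κ : ℂ) ^ 0 *
      cexp (2 * I * (κ : ℂ) * (r : ℂ)) := by
  have hK' : (K : ℂ) ≠ 0 := by exact_mod_cast hK.ne'
  have h := fourierIntegral_gaussian (b := ((1 / K ^ 2 : ℝ) : ℂ))
    (by rw [ofReal_re]; positivity) (2 * r)
  have e1 : (∫ κ : ℝ, ((Real.exp (-(κ / K) ^ 2) : ℝ) : ℂ) * (κ : ℂ) ^ 0 *
      cexp (2 * I * (κ : ℂ) * (r : ℂ))) =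
      ∫ x : ℝ, cexp (I * (2 * r) * x) * cexp (-((1 / K ^ 2 : ℝ) : ℂ) * x ^ 2) := by
    congr 1
    ext x
    rw [pow_zero, mul_one, ofReal_exp, mul_comm]
    congr 2
    · ring
    · push_cast
      field_simp
  rw [e1, h]
  unfold kfun
  push_cast
  congr 1
  · have : (π : ℂ) / (1 / (K : ℂ) ^ 2) = ((π * K ^ 2 : ℝ) : ℂ) := by push_cast; field_simp
    rw [this, show (1 / 2 : ℂ) = ((1 / 2 : ℝ) : ℂ) by push_cast; rfl,
      ← ofReal_cpow (by positivity), ← Real.sqrt_eq_rpow, Real.sqrt_mul (by positivity),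
      Real.sqrt_sq hK.le]
    push_cast
    rfl
  · congr 1
    field_simp
    ring

lemma k_dd {K : ℝ} (hK : 0 < K) (r : ℝ) : ((deriv (deriv (kfun K)) r : ℝ) : ℂ) =
    -4 * ∫ κ : ℝ, ((Real.exp (-(κ / K) ^ 2) : ℝ) : ℂ) * (κ : ℂ) ^ 2 *
      cexp (2 * I * (κ : ℂ) * (r : ℂ)) := by
  have h1 : ∀ t, ((deriv (kfun K) t : ℝ) : ℂ) = _ := fun t => realDeriv
    ((intDeriv hK 0 t).congr_of_eventuallyEq (Filter.Eventually.of_forall (k_eq hK)))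
  have h2 := realDeriv (((intDeriv hK 1 r).const_mul (2 * I)).congr_of_eventuallyEq
    (Filter.Eventually.of_forall h1))
  rw [h2, ← mul_assoc]
  congr 1
  linear_combination 4 * I_mul_I

lemma poissonInt {δ : ℝ} (hδ : 0 < δ) :
    ∫ ω in (0:ℝ)..(2 * π), δ ^ 2 / (Real.sin ω ^ 2 + δ ^ 2) ≤ π ^ 2 * δ := by
  have hpos : ∀ ω : ℝ, 0 < Real.sin ω ^ 2 + δ ^ 2 := fun ω => by positivity
  have hcont : Continuous fun ω : ℝ => δ ^ 2 / (Real.sin ω ^ 2 + δ ^ 2) :=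
    continuous_const.div (by fun_prop) fun ω => (hpos ω).ne'
  have hper : Function.Periodic (fun ω : ℝ => δ ^ 2 / (Real.sin ω ^ 2 + δ ^ 2)) π := by
    intro ω
    simp [Real.sin_add_pi]
  have h1 := intervalIntegral.integral_add_adjacent_intervals
    (hcont.intervalIntegrable 0 π) (hcont.intervalIntegrable π (2 * π))
    (μ := MeasureTheory.volume)
  have h2 := hper.intervalIntegral_add_eq π (-(π / 2))
  have h3 := hper.intervalIntegral_add_eq 0 (-(π / 2))
  rw [show π + π = 2 * π by ring] at h2
  rw [zero_add] at h3
  rw [show -(π / 2) + π = π / 2 by ring] at h2 h3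
  rw [← h1, h2, h3]
  have hpi := Real.pi_pos
  set c : ℝ := 2 / (π * δ) with hc
  have hc0 : 0 < c := by positivity
  have h4 : ∫ ω in (-(π / 2))..(π / 2), δ ^ 2 / (Real.sin ω ^ 2 + δ ^ 2) ≤
      ∫ ω in (-(π / 2))..(π / 2), (1 + (c * ω) ^ 2)⁻¹ := by
    apply intervalIntegral.integral_mono_on (by linarith) (hcont.intervalIntegrable _ _)
    · apply Continuous.intervalIntegrable
      exact Continuous.inv₀ (by fun_prop) fun ω => by positivity
    · intro ω hω
      have h5 := Real.mul_abs_le_abs_sin (x := ω) (abs_le.2 ⟨by linarith [hω.1], hω.2⟩)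
      have h6 : (2 / π * |ω|) ^ 2 ≤ |Real.sin ω| ^ 2 := by gcongr
      rw [sq_abs, mul_pow, sq_abs] at h6
      rw [div_eq_mul_inv, ← inv_inv (δ ^ 2), ← mul_inv]
      apply inv_anti₀ (by positivity)
      have h7 : (c * ω) ^ 2 = (δ ^ 2)⁻¹ * ((2 / π) ^ 2 * ω ^ 2) := by
        rw [hc]; field_simp
      rw [h7]
      have h8 : (δ ^ 2)⁻¹ * δ ^ 2 = 1 := inv_mul_cancel₀ (by positivity)
      have h9 := mul_le_mul_of_nonneg_left h6 (by positivity : 0 ≤ (δ ^ 2)⁻¹)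
      simp only [inv_inv]
      linarith
  have h10 : ∫ ω in (-(π / 2))..(π / 2), (1 + (c * ω) ^ 2)⁻¹ ≤ c⁻¹ * π := by
    rw [intervalIntegral.integral_comp_mul_left (fun z => (1 + z ^ 2)⁻¹) hc0.ne',
      integral_inv_one_add_sq, smul_eq_mul]
    gcongr
    have := Real.arctan_lt_pi_div_two (c * (π / 2))
    have := Real.neg_pi_div_two_lt_arctan (c * -(π / 2))
    linarith
  have h11 : c⁻¹ * π = π ^ 2 * δ / 2 := by rw [hc]; field_simp
  linarith

lemma besI (p : ℤ) {y δ : ℝ} (hδ : 0 < δ) (hδ1 : δ ≤ 1) (hy : 0 < y) (hyδ : 1 ≤ y * δ ^ 3) :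
    ‖∫ ω in (0:ℝ)..(2 * π), cexp (2 * I * (p : ℂ) * (ω : ℂ) + I * (y : ℂ) * (Real.cos ω : ℂ))‖ ≤
      20 * (1 + |(p : ℝ)|) * δ := by
  have hpos : ∀ ω : ℝ, 0 < Real.sin ω ^ 2 + δ ^ 2 := fun ω => by positivity
  have hyC : (y : ℂ) ≠ 0 := by exact_mod_cast hy.ne'
  set E : ℝ → ℂ := fun ω => cexp (2 * I * (p : ℂ) * (ω : ℂ) + I * (y : ℂ) * (Real.cos ω : ℂ))
    with hE
  have hEc : Continuous E := by rw [hE]; fun_prop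
  have hEn : ∀ ω, ‖E ω‖ = 1 := fun ω => by
    rw [hE]
    simp only
    rw [show 2 * I * (p : ℂ) * (ω : ℂ) + I * (y : ℂ) * (Real.cos ω : ℂ)
      = ((2 * p * ω + y * Real.cos ω : ℝ) : ℂ) * I by push_cast; ring]
    exact norm_exp_ofReal_mul_I _
  have hqc : Continuous fun ω : ℝ => δ ^ 2 / (Real.sin ω ^ 2 + δ ^ 2) :=
    continuous_const.div (by fun_prop) fun ω => (hpos ω).ne'
  have hsc : Continuous fun ω : ℝ => Real.sin ω / (Real.sin ω ^ 2 + δ ^ 2) :=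
    Real.continuous_sin.div (by fun_prop) fun ω => (hpos ω).ne'
  set u : ℝ → ℂ := fun ω => cexp (2 * I * (p : ℂ) * (ω : ℂ)) *
    ((Real.sin ω / (Real.sin ω ^ 2 + δ ^ 2) : ℝ) : ℂ) with hu
  set v : ℝ → ℂ := fun ω => cexp (I * (y : ℂ) * (Real.cos ω : ℂ)) with hv
  set u' : ℝ → ℂ := fun ω => cexp (2 * I * (p : ℂ) * (ω : ℂ)) * (2 * I * (p : ℂ)) *
      ((Real.sin ω / (Real.sin ω ^ 2 + δ ^ 2) : ℝ) : ℂ) +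
      cexp (2 * I * (p : ℂ) * (ω : ℂ)) * ((Real.cos ω * (δ ^ 2 - Real.sin ω ^ 2) /
        (Real.sin ω ^ 2 + δ ^ 2) ^ 2 : ℝ) : ℂ) with hu'
  set v' : ℝ → ℂ := fun ω => v ω * (I * y * ((-Real.sin ω : ℝ) : ℂ)) with hv'
  have hdu : ∀ ω, HasDerivAt u (u' ω) ω := by
    intro ω
    have h1 : HasDerivAt (fun s : ℝ => 2 * I * (p : ℂ) * (s : ℂ)) (2 * I * (p : ℂ) * 1) ω :=
      (HasDerivAt.ofReal_comp (hasDerivAt_id ω)).const_mul _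
    have h2 : HasDerivAt (fun s : ℝ => Real.sin s / (Real.sin s ^ 2 + δ ^ 2))
        (Real.cos ω * (δ ^ 2 - Real.sin ω ^ 2) / (Real.sin ω ^ 2 + δ ^ 2) ^ 2) ω := by
      refine ((Real.hasDerivAt_sin ω).div (((Real.hasDerivAt_sin ω).pow 2).add_const (δ ^ 2))
        (hpos ω).ne').congr_deriv ?_
      congr 1
      simp
      ring
    refine (h1.cexp.mul h2.ofReal_comp).congr_deriv ?_
    rw [hu', mul_one]
  have hdv : ∀ ω, HasDerivAt v (v' ω) ω := by
    intro ω
    exact ((Real.hasDerivAt_cos ω).ofReal_comp.const_mul (I * (y : ℂ))).cexp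
  have hu'c : Continuous u' := by
    have h3 : Continuous fun ω : ℝ => Real.cos ω * (δ ^ 2 - Real.sin ω ^ 2) /
        (Real.sin ω ^ 2 + δ ^ 2) ^ 2 :=
      Continuous.div (by fun_prop) (by fun_prop) fun ω => (pow_pos (hpos ω) 2).ne'
    rw [hu']
    fun_prop
  have hvc : Continuous v := by rw [hv]; fun_prop
  have hv'c : Continuous v' := by rw [hv']; fun_prop
  have hparts := intervalIntegral.integral_mul_deriv_eq_deriv_mul (a := 0) (b := 2 * π)
    (fun ω _ => hdu ω) (fun ω _ => hdv ω) (hu'c.intervalIntegrable _ _)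
    (hv'c.intervalIntegrable _ _)
  have hu0 : u 0 = 0 := by simp [hu]
  have hu1 : u (2 * π) = 0 := by simp [hu]
  rw [hu0, hu1] at hparts
  have hsplit : ∀ ω, E ω = ((δ ^ 2 / (Real.sin ω ^ 2 + δ ^ 2) : ℝ) : ℂ) * E ω +
      (I / y) * (u ω * v' ω) := by
    intro ω
    have h5 : (I / y) * (u ω * v' ω) =
        ((Real.sin ω ^ 2 / (Real.sin ω ^ 2 + δ ^ 2) : ℝ) : ℂ) * E ω := by
      rw [hu, hv', hv, hE]
      simp only
      rw [Complex.exp_add]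
      have : I / (y : ℂ) * (I * y) = -1 := by
        field_simp
        exact I_sq
      have h6 : Real.sin ω ^ 2 / (Real.sin ω ^ 2 + δ ^ 2) =
        Real.sin ω * (Real.sin ω / (Real.sin ω ^ 2 + δ ^ 2)) := by ring
      rw [h6, ofReal_mul, ofReal_neg]
      generalize ((Real.sin ω / (Real.sin ω ^ 2 + δ ^ 2) : ℝ) : ℂ) = A
      linear_combination (-cexp (2 * I * (p : ℂ) * (ω : ℂ)) * A *
        cexp (I * (y : ℂ) * (Real.cos ω : ℂ)) * (Real.sin ω : ℂ)) * this
    rw [h5, ← add_mul, ← ofReal_add, ← add_div, add_comm (δ ^ 2), div_self (hpos ω).ne']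
    simp
  have hint : ∫ ω in (0:ℝ)..(2 * π), E ω =
      (∫ ω in (0:ℝ)..(2 * π), ((δ ^ 2 / (Real.sin ω ^ 2 + δ ^ 2) : ℝ) : ℂ) * E ω) +
        (I / y) * (-∫ ω in (0:ℝ)..(2 * π), u' ω * v ω) := by
    have hc1 : Continuous fun ω => ((δ ^ 2 / (Real.sin ω ^ 2 + δ ^ 2) : ℝ) : ℂ) * E ω := by
      fun_prop
    have huc : Continuous u := by rw [hu]; fun_prop
    have hc2 : Continuous fun ω => (I / y) * (u ω * v' ω) := by fun_prop
    rw [intervalIntegral.integral_congr (g := fun ω =>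
      ((δ ^ 2 / (Real.sin ω ^ 2 + δ ^ 2) : ℝ) : ℂ) * E ω + (I / y) * (u ω * v' ω))
      (fun ω _ => hsplit ω),
      intervalIntegral.integral_add (hc1.intervalIntegrable _ _) (hc2.intervalIntegrable _ _),
      intervalIntegral.integral_const_mul, hparts]
    simp
  have hb1 : ‖∫ ω in (0:ℝ)..(2 * π), ((δ ^ 2 / (Real.sin ω ^ 2 + δ ^ 2) : ℝ) : ℂ) * E ω‖ ≤
      π ^ 2 * δ := by
    refine (intervalIntegral.norm_integral_le_integral_norm (by positivity)).trans
      (le_trans (le_of_eq ?_) (poissonInt hδ))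
    refine intervalIntegral.integral_congr fun ω _ => ?_
    rw [norm_mul, hEn, mul_one, norm_real, Real.norm_eq_abs, abs_of_nonneg]
    have := hpos ω
    positivity
  have hb2 : ‖∫ ω in (0:ℝ)..(2 * π), u' ω * v ω‖ ≤
      (|(p : ℝ)| / δ + 1 / δ ^ 2) * |2 * π - 0| := by
    refine intervalIntegral.norm_integral_le_of_norm_le_const fun ω _ => ?_
    have hvn : ‖v ω‖ = 1 := by
      rw [hv]
      simp only
      rw [show I * (y : ℂ) * (Real.cos ω : ℂ)
        = ((y * Real.cos ω : ℝ) : ℂ) * I by push_cast; ring]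
      exact norm_exp_ofReal_mul_I _
    have hen : ‖cexp (2 * I * (p : ℂ) * (ω : ℂ))‖ = 1 := by
      have := normE p ω
      simpa using this
    rw [norm_mul, hvn, mul_one, hu']
    refine (norm_add_le _ _).trans (add_le_add ?_ ?_)
    · rw [norm_mul, norm_mul, hen, norm_real]
      have : ‖2 * I * (p : ℂ)‖ = 2 * |(p : ℝ)| := by simp
      rw [this, one_mul, Real.norm_eq_abs, abs_div, abs_of_pos (hpos ω)]
      have h7 : |Real.sin ω| / (Real.sin ω ^ 2 + δ ^ 2) ≤ 1 / (2 * δ) := by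
        rw [div_le_div_iff₀ (hpos ω) (by positivity), ← sq_abs (Real.sin ω)]
        nlinarith [sq_nonneg (|Real.sin ω| - δ)]
      calc 2 * |(p : ℝ)| * (|Real.sin ω| / (Real.sin ω ^ 2 + δ ^ 2))
          ≤ 2 * |(p : ℝ)| * (1 / (2 * δ)) := by gcongr
        _ = |(p : ℝ)| / δ := by field_simp
    · rw [norm_mul, hen, one_mul, norm_real, Real.norm_eq_abs, abs_div, abs_mul,
        abs_of_pos (pow_pos (hpos ω) 2), div_le_div_iff₀ (pow_pos (hpos ω) 2) (by positivity)]
      have h8 := Real.abs_cos_le_one ω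
      have h9 : |δ ^ 2 - Real.sin ω ^ 2| ≤ Real.sin ω ^ 2 + δ ^ 2 := by
        rw [abs_le]; constructor <;> nlinarith [sq_nonneg δ, sq_nonneg (Real.sin ω)]
      have h10 : |Real.cos ω| * |δ ^ 2 - Real.sin ω ^ 2| ≤ 1 * (Real.sin ω ^ 2 + δ ^ 2) := by
        gcongr
      have h11 : δ ^ 2 ≤ Real.sin ω ^ 2 + δ ^ 2 := by nlinarith [sq_nonneg (Real.sin ω)]
      calc |Real.cos ω| * |δ ^ 2 - Real.sin ω ^ 2| * δ ^ 2
          ≤ (1 * (Real.sin ω ^ 2 + δ ^ 2)) * (Real.sin ω ^ 2 + δ ^ 2) := by gcongr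
        _ = 1 * (Real.sin ω ^ 2 + δ ^ 2) ^ 2 := by ring
  have hpi := Real.pi_pos
  have hpi2 : π < 3.15 := Real.pi_lt_d2
  rw [hint]
  refine (norm_add_le _ _).trans ((add_le_add_left hb1 _).trans ?_)
  rw [norm_mul, norm_neg]
  have hIy : ‖I / (y : ℂ)‖ = 1 / y := by simp [abs_of_pos hy]
  rw [hIy]
  have hy3 : 1 / y ≤ δ ^ 3 := by rw [div_le_iff₀ hy]; linarith
  rw [sub_zero, abs_of_pos (by positivity : 0 < 2 * π)] at hb2
  have h12 : 1 / y * ‖∫ ω in (0:ℝ)..(2 * π), u' ω * v ω‖ ≤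
      δ ^ 3 * ((|(p : ℝ)| / δ + 1 / δ ^ 2) * (2 * π)) := by gcongr
  have h13 : δ ^ 3 * ((|(p : ℝ)| / δ + 1 / δ ^ 2) * (2 * π)) =
      (|(p : ℝ)| * δ * δ + δ) * (2 * π) := by field_simp
  have h14 : |(p : ℝ)| * δ * δ ≤ |(p : ℝ)| * δ * 1 := by gcongr
  have h15 : 0 ≤ |(p : ℝ)| * δ := by positivity
  have h16 : (|(p : ℝ)| * δ * δ + δ) * (2 * π) ≤ (|(p : ℝ)| * δ + δ) * 6.3 :=
    mul_le_mul (by linarith) (by linarith) (by positivity) (by positivity)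
  have h17 : π ^ 2 * δ ≤ 10 * δ := by gcongr; nlinarith
  nlinarith

/-- The real phase `Re(e^{iφ} trh(r,ω))`. -/
noncomputable def phase (φ r ω : ℝ) : ℝ :=
  Real.cosh r * Real.cos φ * Real.cos ω - Real.sinh r * Real.sin φ * Real.sin ω

/-- The inner angular integral. -/
noncomputable def gg (x φ : ℝ) (p : ℤ) (r : ℝ) : ℂ :=
  ∫ ω in (0:ℝ)..π, cexp (2 * I * ((p : ℝ) : ℂ) * (ω : ℂ)) *
    ((Real.cos (2 * x * phase φ r ω) : ℝ) : ℂ)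

lemma cosh_re_im (r φ : ℝ) : Complex.cosh ((r : ℂ) + I * (φ : ℂ)) =
    ((Real.cosh r * Real.cos φ : ℝ) : ℂ) + ((Real.sinh r * Real.sin φ : ℝ) : ℂ) * I := by
  rw [mul_comm I, Complex.cosh_add, Complex.cosh_mul_I, Complex.sinh_mul_I]
  push_cast
  ring

lemma gg_cont (x φ : ℝ) (p : ℤ) : Continuous (gg x φ p) := by
  unfold gg phase
  apply intervalIntegral.continuous_parametric_intervalIntegral_of_continuous'
  simp only [Function.uncurry_def]
  fun_prop

lemma core (x φ : ℝ) (p : ℤ) (r : ℝ) (hw : Complex.cosh ((r : ℂ) + I * (φ : ℂ)) ≠ 0) :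
    2 * (conj (Complex.cosh ((r : ℂ) + I * (φ : ℂ))) /
      (‖Complex.cosh ((r : ℂ) + I * (φ : ℂ))‖ : ℂ)) ^ (2 * p) *
      (∫ ω in (0:ℝ)..(2 * π), cexp (2 * I * (p : ℂ) * (ω : ℂ) +
        I * ((2 * x * ‖Complex.cosh ((r : ℂ) + I * (φ : ℂ))‖ : ℝ) : ℂ) * (Real.cos ω : ℂ))) =
    4 * gg x φ p r := by
  set w := Complex.cosh ((r : ℂ) + I * (φ : ℂ)) with hwdef
  have hre : w.re = Real.cosh r * Real.cos φ := by
    rw [hwdef, cosh_re_im]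
    simp only [add_re, add_im, mul_re, mul_im, ofReal_re, ofReal_im, I_re, I_im]
    ring
  have him : w.im = Real.sinh r * Real.sin φ := by
    rw [hwdef, cosh_re_im]
    simp only [add_re, add_im, mul_re, mul_im, ofReal_re, ofReal_im, I_re, I_im]
    ring
  set α := arg w with hα
  have hn : (‖w‖ : ℂ) ≠ 0 := by exact_mod_cast (norm_ne_zero_iff.2 hw)
  have hc1 : ‖w‖ * Real.cos α = Real.cosh r * Real.cos φ := by
    rw [← hre, hα]; exact norm_mul_cos_arg w
  have hs1 : ‖w‖ * Real.sin α = Real.sinh r * Real.sin φ := by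
    rw [← him, hα]; exact norm_mul_sin_arg w
  have hphase : ∀ ω, ‖w‖ * Real.cos (ω + α) = phase φ r ω := by
    intro ω
    unfold phase
    rw [Real.cos_add, ← hc1, ← hs1]
    ring
  have hconj : conj w / (‖w‖ : ℂ) = cexp (-(α * I)) := by
    have h1 : w = (‖w‖ : ℂ) * cexp (α * I) := (norm_mul_exp_arg_mul_I w).symm
    have h2 : conj w = (‖w‖ : ℂ) * cexp (-(α * I)) := by
      conv_lhs => rw [h1]
      rw [map_mul, conj_ofReal, ← Complex.exp_conj, map_mul, conj_ofReal, conj_I]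
      congr 2
      ring
    rw [h2]
    field_simp
  set G : ℝ → ℂ := fun ω => cexp (2 * I * (p : ℂ) * (ω : ℂ) +
    I * ((2 * x * phase φ r ω : ℝ) : ℂ)) with hG
  have hGc : Continuous G := by
    rw [hG]; unfold phase; fun_prop
  have hpexp : cexp (2 * I * (p : ℂ) * (π : ℂ)) = 1 := by
    rw [Complex.exp_eq_one_iff]
    exact ⟨p, by ring⟩
  have hGpi : ∀ ω, G (ω + π) = cexp (2 * I * (p : ℂ) * (ω : ℂ) -
      I * ((2 * x * phase φ r ω : ℝ) : ℂ)) := by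
    intro ω
    have : phase φ r (ω + π) = - phase φ r ω := by
      unfold phase
      rw [Real.cos_add_pi, Real.sin_add_pi]; ring
    rw [hG]
    simp only
    rw [this, show 2 * I * (p : ℂ) * ((ω + π : ℝ) : ℂ) + I * ((2 * x * -phase φ r ω : ℝ) : ℂ)
      = (2 * I * (p : ℂ) * (ω : ℂ) - I * ((2 * x * phase φ r ω : ℝ) : ℂ)) +
        2 * I * (p : ℂ) * (π : ℂ) by push_cast; ring, Complex.exp_add, hpexp, mul_one]
  have hGper : Function.Periodic G (2 * π) := by
    intro ω
    rw [show ω + 2 * π = (ω + π) + π by ring, hGpi]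
    have : phase φ r (ω + π) = - phase φ r ω := by
      unfold phase
      rw [Real.cos_add_pi, Real.sin_add_pi]; ring
    rw [this, hG]
    simp only
    rw [show 2 * I * (p : ℂ) * ((ω + π : ℝ) : ℂ) - I * ((2 * x * -phase φ r ω : ℝ) : ℂ)
      = (2 * I * (p : ℂ) * (ω : ℂ) + I * ((2 * x * phase φ r ω : ℝ) : ℂ)) +
        2 * I * (p : ℂ) * (π : ℂ) by push_cast; ring, Complex.exp_add, hpexp, mul_one]
  have e1 : (conj w / (‖w‖ : ℂ)) ^ (2 * p) * (∫ ω in (0:ℝ)..(2 * π),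
      cexp (2 * I * (p : ℂ) * (ω : ℂ) + I * ((2 * x * ‖w‖ : ℝ) : ℂ) * (Real.cos ω : ℂ))) =
      ∫ ω in (0:ℝ)..(2 * π), G (ω - α) := by
    rw [hconj, ← Complex.exp_int_mul, ← intervalIntegral.integral_const_mul]
    refine intervalIntegral.integral_congr fun ω _ => ?_
    simp only [hG]
    rw [← Complex.exp_add]
    have := hphase (ω - α)
    rw [sub_add_cancel] at this
    rw [← this]
    congr 1
    push_cast
    ring
  have e2 : ∫ ω in (0:ℝ)..(2 * π), G (ω - α) = ∫ ω in (0:ℝ)..(2 * π), G ω := by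
    rw [intervalIntegral.integral_comp_sub_right]
    have := hGper.intervalIntegral_add_eq (0 - α) 0
    rw [zero_add] at this
    rw [← this]
    congr 1
    ring
  have e3 : ∫ ω in (0:ℝ)..(2 * π), G ω = 2 * gg x φ p r := by
    rw [← intervalIntegral.integral_add_adjacent_intervals
      (hGc.intervalIntegrable 0 π) (hGc.intervalIntegrable π (2 * π))]
    have h3 := intervalIntegral.integral_comp_add_right (a := 0) (b := π) G π
    rw [zero_add, show π + π = 2 * π by ring] at h3
    have hGc2 : Continuous fun ω => G (ω + π) := by fun_prop
    rw [← h3, ← intervalIntegral.integral_add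
      (hGc.intervalIntegrable 0 π) (hGc2.intervalIntegrable 0 π)]
    unfold gg
    rw [← intervalIntegral.integral_const_mul]
    refine intervalIntegral.integral_congr fun ω _ => ?_
    rw [hGpi, hG]
    simp only
    rw [Complex.exp_add, sub_eq_add_neg, Complex.exp_add, ofReal_cos, Complex.cos]
    rw [show -(I * ((2 * x * phase φ r ω : ℝ) : ℂ)) = -((2 * x * phase φ r ω : ℝ) : ℂ) * I by ring,
      mul_comm I ((2 * x * phase φ r ω : ℝ) : ℂ)]
    push_cast
    ring
  rw [mul_assoc, e1, e2, e3]
  ring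

lemma gg_triv (x φ : ℝ) (p : ℤ) (r : ℝ) : ‖gg x φ p r‖ ≤ π := by
  unfold gg
  have := intervalIntegral.norm_integral_le_of_norm_le_const (a := 0) (b := π) (C := 1)
    (f := fun ω : ℝ => cexp (2 * I * ((p : ℝ) : ℂ) * (ω : ℂ)) *
      ((Real.cos (2 * x * phase φ r ω) : ℝ) : ℂ)) (fun ω _ => by
      rw [norm_mul, normE, one_mul, norm_real]
      exact Real.abs_cos_le_one _)
  rwa [one_mul, sub_zero, abs_of_pos Real.pi_pos] at this

lemma norm_cosh_ge (r φ : ℝ) : |Real.sinh r| ≤ ‖Complex.cosh ((r : ℂ) + I * (φ : ℂ))‖ := by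
  refine abs_le_of_sq_le_sq' ?_ (norm_nonneg _) |> fun h => abs_le.2 h
  rw [← Complex.normSq_eq_norm_sq, cosh_re_im, Complex.normSq_add_mul_I]
  nlinarith [Real.cosh_sq r, Real.sin_sq_add_cos_sq φ, sq_nonneg (Real.cos φ)]

lemma cosh_ne {r : ℝ} (hr : r ≠ 0) (φ : ℝ) : Complex.cosh ((r : ℂ) + I * (φ : ℂ)) ≠ 0 := by
  intro h
  have := norm_cosh_ge r φ
  rw [h, norm_zero] at this
  have h2 := abs_nonpos_iff.1 this
  exact hr (Real.sinh_eq_zero.1 h2)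

lemma gg_bound {x : ℝ} (hx : 0 < x) (φ : ℝ) (p : ℤ) (r : ℝ) :
    ‖4 * gg x φ p r‖ ≤ 40 * (1 + |(p : ℝ)|) * ((2 + 2 / x) * Real.exp (-(1 / 3) * |r|)) := by
  have htriv := gg_triv x φ p r
  have hpi2 : π < 3.15 := Real.pi_lt_d2
  have hn4 : ‖4 * gg x φ p r‖ = 4 * ‖gg x φ p r‖ := by rw [norm_mul]; simp
  set δ := (2 + 2 / x) * Real.exp (-(1 / 3) * |r|) with hδ
  have hx2 : 0 < 2 / x := by positivity
  have hδ0 : 0 < δ := by positivity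
  have hp := abs_nonneg (p : ℝ)
  by_cases h1 : δ ≤ 1
  · have hr : 1 ≤ |r| := by
      by_contra! hlt
      have h2 := Real.add_one_le_exp (-(1 / 3) * |r|)
      have : 1 < δ := by
        calc (1:ℝ) < 2 * (2 / 3) := by norm_num
          _ ≤ δ := by
            rw [hδ]
            gcongr <;> linarith
      linarith
    have hr0 : r ≠ 0 := by
      intro h; rw [h, abs_zero] at hr; linarith
    rw [← core x φ p r (cosh_ne hr0 φ)]
    have hs : |Real.sinh r| = Real.sinh |r| := Real.abs_sinh r
    have hge := norm_cosh_ge r φ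
    set N := ‖Complex.cosh ((r : ℂ) + I * (φ : ℂ))‖ with hN
    have hNpos : 0 < N := norm_pos_iff.2 (cosh_ne hr0 φ)
    have hNne : (N : ℂ) ≠ 0 := by exact_mod_cast hNpos.ne'
    have hδ3 : δ ^ 3 = (2 + 2 / x) ^ 3 * Real.exp (-|r|) := by
      rw [hδ, mul_pow, ← Real.exp_nat_mul]
      congr 2
      push_cast
      ring
    have hsh : 1 / 4 ≤ Real.sinh |r| * Real.exp (-|r|) := by
      rw [Real.sinh_eq, div_mul_eq_mul_div, sub_mul, ← Real.exp_add, ← Real.exp_add]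
      have h3 : Real.exp (-|r| + -|r|) ≤ 1 / 2 := by
        rw [show -|r| + -|r| = -(2 * |r|) by ring, Real.exp_neg, one_div]
        apply inv_anti₀ (by norm_num)
        linarith [Real.add_one_le_exp (2 * |r|)]
      rw [add_neg_cancel, Real.exp_zero]
      linarith
    have hyδ : 1 ≤ (2 * x * N) * δ ^ 3 := by
      rw [hδ3]
      have h4 : 1 / 4 ≤ N * Real.exp (-|r|) := by
        refine hsh.trans ?_
        rw [hs] at hge
        gcongr
      have h5 : 2 ≤ x * (2 + 2 / x) := by
        rw [mul_add, mul_div_cancel₀ _ hx.ne']; linarith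
      have h6 : 1 ≤ (2 + 2 / x) ^ 2 := by nlinarith
      calc (1:ℝ) = 2 * 2 * 1 * (1 / 4) := by norm_num
        _ ≤ 2 * (x * (2 + 2 / x)) * ((2 + 2 / x) ^ 2) * (N * Real.exp (-|r|)) := by gcongr
        _ = _ := by ring
    have hb := besI p (y := 2 * x * N) hδ0 h1 (by positivity) hyδ
    have hunit : ‖conj (Complex.cosh ((r : ℂ) + I * (φ : ℂ))) / (N : ℂ)‖ = 1 := by
      rw [norm_div, RCLike.norm_conj, norm_real, norm_norm, ← hN, div_self hNpos.ne']
    rw [norm_mul, norm_mul, norm_zpow, hunit, one_zpow, mul_one]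
    have h22 : ‖(2 : ℂ)‖ = 2 := by simp
    rw [h22]
    linarith
  · push Not at h1
    rw [hn4]
    nlinarith

lemma Jbold_eq (x φ κ : ℝ) (p : ℤ) : Jbold x φ κ p =
    ∫ r : ℝ, 4 * gg x φ p r * cexp (2 * I * (κ : ℂ) * (r : ℂ)) := by
  unfold Jbold
  rw [← MeasureTheory.integral_const_mul]
  apply MeasureTheory.integral_congr_ae
  filter_upwards [(Set.countable_singleton (0:ℝ)).ae_notMem MeasureTheory.volume] with r hr
  have hw := cosh_ne (r := r) hr φ
  rw [if_neg hw, ← core x φ p r hw]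
  unfold besselJ
  have h1 : I ^ (2 * p) ≠ 0 := zpow_ne_zero _ I_ne_zero
  have h2 : (π : ℂ) ≠ 0 := by exact_mod_cast Real.pi_ne_zero
  rw [show 2 * I * (κ : ℂ) * (r : ℂ) = 2 * I * (r : ℂ) * (κ : ℂ) by ring]
  field_simp
  ring

lemma int_exp_abs : MeasureTheory.Integrable fun r : ℝ => Real.exp (-(1 / 3) * |r|) := by
  have h1 : MeasureTheory.IntegrableOn (fun r : ℝ => Real.exp (-(1 / 3) * r)) (Set.Ioi 0) :=
    integrableOn_exp_mul_Ioi (by norm_num) 0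
  have h2 : MeasureTheory.IntegrableOn (fun r : ℝ => Real.exp ((1 / 3) * r)) (Set.Iic 0) :=
    integrableOn_exp_mul_Iic (by norm_num) 0
  rw [← MeasureTheory.integrableOn_univ, ← Set.Iic_union_Ioi (a := (0:ℝ)),
    MeasureTheory.integrableOn_union]
  constructor
  · refine h2.congr_fun (fun r hr => ?_) measurableSet_Iic
    simp only
    rw [abs_of_nonpos hr]
    congr 1
    ring
  · refine h1.congr_fun (fun r hr => ?_) measurableSet_Ioi
    simp only
    rw [abs_of_pos hr]

lemma swap3 {Φ : ℤ → ℝ → ℝ → ℂ} (hc : ∀ p, Continuous (Function.uncurry (Φ p)))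
    {a : ℤ → ℝ → ℝ} (ha : ∀ p, MeasureTheory.Integrable (a p)) {b : ℝ → ℝ}
    (hb : MeasureTheory.Integrable b) (hbd : ∀ p κ r, ‖Φ p κ r‖ ≤ a p κ * b r)
    (hs : Summable fun p => ∫ κ, a p κ) :
    ∫ κ, ∑' p, ∫ r, Φ p κ r = ∫ r, ∑' p, ∫ κ, Φ p κ r := by
  have hI : ∀ p, MeasureTheory.Integrable (Function.uncurry (Φ p))
      (MeasureTheory.volume.prod MeasureTheory.volume) := fun p =>
    ((ha p).mul_prod hb).mono' (hc p).aestronglyMeasurable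
      (Filter.Eventually.of_forall fun z => hbd p z.1 z.2)
  have hs' := hs.mul_right (∫ r, b r)
  have hL := MeasureTheory.integral_tsum_of_summable_integral_norm
    (F := fun p κ => ∫ r, Φ p κ r) (μ := MeasureTheory.volume)
    (fun p => (hI p).integral_prod_left)
    (Summable.of_nonneg_of_le (fun p => by positivity) (fun p => by
      rw [← MeasureTheory.integral_mul_const]
      refine MeasureTheory.integral_mono (hI p).integral_prod_left.norm
        ((ha p).mul_const _) fun κ => ?_
      simp only
      rw [← MeasureTheory.integral_const_mul]
      exact MeasureTheory.norm_integral_le_of_norm_le (hb.const_mul _)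
        (Filter.Eventually.of_forall fun r => hbd p κ r)) hs')
  have hR := MeasureTheory.integral_tsum_of_summable_integral_norm
    (F := fun p r => ∫ κ, Φ p κ r) (μ := MeasureTheory.volume)
    (fun p => (hI p).integral_prod_right)
    (Summable.of_nonneg_of_le (fun p => by positivity) (fun p => by
      rw [← MeasureTheory.integral_const_mul]
      refine MeasureTheory.integral_mono (hI p).integral_prod_right.norm
        (hb.const_mul _) fun r => ?_
      simp only
      rw [← MeasureTheory.integral_mul_const]
      exact MeasureTheory.norm_integral_le_of_norm_le ((ha p).mul_const _)
        (Filter.Eventually.of_forall fun κ => hbd p κ r)) hs')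
  rw [← hL, ← hR]
  exact tsum_congr fun p => MeasureTheory.integral_integral_swap (hI p)

lemma phase_eq (x φ r ω : ℝ) :
    2 * (((x : ℂ) * Complex.exp (Complex.I * (φ : ℂ))) * trh r ω).re = 2 * x * phase φ r ω := by
  unfold trh phase
  rw [mul_comm I, Complex.exp_mul_I, ← ofReal_cos, ← ofReal_sin]
  simp only [add_re, add_im, mul_re, mul_im, ofReal_re, ofReal_im, I_re, I_im]
  ring

lemma inner_eq {K P : ℝ} (hK : 0 < K) (hP : 0 < P) (x φ r : ℝ) :
    ∑' p : ℤ, ((Real.exp (-((p : ℝ) / P) ^ 2) : ℝ) : ℂ) *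
      ((∫ κ : ℝ, ((Real.exp (-(κ / K) ^ 2) : ℝ) : ℂ) * (κ : ℂ) ^ 2 *
        cexp (2 * I * (κ : ℂ) * (r : ℂ))) +
      ((p : ℝ) : ℂ) ^ 2 * (∫ κ : ℝ, ((Real.exp (-(κ / K) ^ 2) : ℝ) : ℂ) * (κ : ℂ) ^ 0 *
        cexp (2 * I * (κ : ℂ) * (r : ℂ)))) * (4 * gg x φ p r) =
    -∫ ω in (0:ℝ)..π, ((Real.cos (2 * x * phase φ r ω) *
      (deriv (deriv (kfun K)) r * thetafun P ω +
              kfun K r * deriv (deriv (thetafun P)) ω) : ℝ) : ℂ) := by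
  set G2 := ∫ κ : ℝ, ((Real.exp (-(κ / K) ^ 2) : ℝ) : ℂ) * (κ : ℂ) ^ 2 *
        cexp (2 * I * (κ : ℂ) * (r : ℂ)) with hG2
  set G0 := ∫ κ : ℝ, ((Real.exp (-(κ / K) ^ 2) : ℝ) : ℂ) * (κ : ℂ) ^ 0 *
        cexp (2 * I * (κ : ℂ) * (r : ℂ)) with hG0
  have hk2 := k_dd hK r
  have hk0 := k_eq hK r
  rw [← hG2] at hk2
  rw [← hG0] at hk0
  have hsum : Summable fun p : ℤ => 4 * ‖G2‖ * (|(p : ℝ)| ^ 0 * Real.exp (-((p : ℝ) / P) ^ 2)) +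
      4 * ‖G0‖ * (|(p : ℝ)| ^ 2 * Real.exp (-((p : ℝ) / P) ^ 2)) :=
    ((sumG hP 0).mul_left _).add ((sumG hP 2).mul_left _)
  have h := intervalIntegral.hasSum_integral_of_dominated_convergence
    (μ := MeasureTheory.volume) (a := 0) (b := π)
    (F := fun (p : ℤ) (ω : ℝ) => ((Real.exp (-((p : ℝ) / P) ^ 2) : ℝ) : ℂ) *
      (G2 + ((p : ℝ) : ℂ) ^ 2 * G0) * (4 * (cexp (2 * I * ((p : ℝ) : ℂ) * (ω : ℂ)) *
    ((Real.cos (2 * x * phase φ r ω) : ℝ) : ℂ))))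
    (f := fun ω => -((Real.cos (2 * x * phase φ r ω) *
      (deriv (deriv (kfun K)) r * thetafun P ω +
              kfun K r * deriv (deriv (thetafun P)) ω) : ℝ) : ℂ))
    (fun p _ => 4 * ‖G2‖ * (|(p : ℝ)| ^ 0 * Real.exp (-((p : ℝ) / P) ^ 2)) +
      4 * ‖G0‖ * (|(p : ℝ)| ^ 2 * Real.exp (-((p : ℝ) / P) ^ 2)))
    (fun p => by
      apply Continuous.aestronglyMeasurable
      unfold phase
      fun_prop)
    (fun p => Filter.Eventually.of_forall fun ω _ => by
      rw [norm_mul, norm_mul, norm_mul, norm_mul, normE, norm_real, norm_real,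
        Real.norm_eq_abs, Real.norm_eq_abs, Real.abs_exp]
      have h1 : ‖G2 + ((p : ℝ) : ℂ) ^ 2 * G0‖ ≤ ‖G2‖ + |(p : ℝ)| ^ 2 * ‖G0‖ := by
        refine (norm_add_le _ _).trans (le_of_eq ?_)
        rw [norm_mul, norm_pow, norm_real, Real.norm_eq_abs]
      have h2 := Real.abs_cos_le_one (2 * x * phase φ r ω)
      have h4 : ‖(4 : ℂ)‖ = 4 := by simp
      rw [h4]
      calc _ ≤ Real.exp (-((p : ℝ) / P) ^ 2) * (‖G2‖ + |(p : ℝ)| ^ 2 * ‖G0‖) * (4 * (1 * 1)) := by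
            gcongr
        _ = _ := by ring)
    (Filter.Eventually.of_forall fun ω _ => hsum)
    intervalIntegrable_const
    (Filter.Eventually.of_forall fun ω _ => by
      have s0 := (sumE hP 0 ω).hasSum
      have s2 := (sumE hP 2 ω).hasSum
      rw [← theta_eq hP] at s0
      have s3 := (s0.mul_left (4 * G2)).add (s2.mul_left (4 * G0))
      have s4 := s3.mul_right ((Real.cos (2 * x * phase φ r ω) : ℝ) : ℂ)
      convert! s4 using 1
      · ext p
        ring
      · push_cast [-ofReal_cos]
        rw [hk2, hk0, theta_dd hP]
        push_cast
        ring)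
  rw [← intervalIntegral.integral_neg, ← h.tsum_eq]
  refine tsum_congr fun p => ?_
  unfold gg
  rw [intervalIntegral.integral_const_mul, intervalIntegral.integral_const_mul]

/-- The Bessel integral `∫∫_𝒜 h(κ,p) 𝐉_{iκ,p}(x e^{iφ}) (κ²+p²) dμ(κ,p)` with
`h(κ,p) = exp(−κ²/K² − p²/P²)` equals
`−∫∫ cos(2 Re(x e^{iφ} trh(r,ω))) (k''(r)θ(ω) + k(r)θ''(ω)) dω dr`. -/
theorem bessel_integral_repn (K P : ℝ) (hK : 0 < K) (hP : 0 < P) (x φ : ℝ) (hx : 0 < x) :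
    (∫ κ : ℝ, ∑' p : ℤ,
        ((Real.exp (-(κ / K) ^ 2 - ((p : ℝ) / P) ^ 2) : ℝ) : ℂ) * Jbold x φ κ p *
          ((κ : ℂ) ^ 2 + (p : ℂ) ^ 2)) =
      ((-(∫ r : ℝ, ∫ ω in (0:ℝ)..Real.pi,
          Real.cos (2 * (((x : ℂ) * Complex.exp (Complex.I * (φ : ℂ))) * trh r ω).re) *
            (deriv (deriv (kfun K)) r * thetafun P ω +
              kfun K r * deriv (deriv (thetafun P)) ω)) : ℝ) : ℂ) := by
  have h0 : ∀ κ : ℝ, ∀ p : ℤ,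
      ((Real.exp (-(κ / K) ^ 2 - ((p : ℝ) / P) ^ 2) : ℝ) : ℂ) * Jbold x φ κ p *
          ((κ : ℂ) ^ 2 + (p : ℂ) ^ 2) = ∫ r : ℝ,
      ((Real.exp (-((p : ℝ) / P) ^ 2) : ℝ) : ℂ) * (((Real.exp (-(κ / K) ^ 2) : ℝ) : ℂ) *
        (κ : ℂ) ^ 2 * cexp (2 * I * (κ : ℂ) * (r : ℂ)) + ((p : ℝ) : ℂ) ^ 2 *
        (((Real.exp (-(κ / K) ^ 2) : ℝ) : ℂ) *
        (κ : ℂ) ^ 0 * cexp (2 * I * (κ : ℂ) * (r : ℂ)))) * (4 * gg x φ p r) := by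
    intro κ p
    rw [Jbold_eq, mul_right_comm, ← MeasureTheory.integral_const_mul]
    congr 1
    ext r
    rw [sub_eq_add_neg, Real.exp_add, ofReal_mul, ofReal_intCast]
    ring
  simp_rw [h0]
  have hexp : ∀ (p : ℤ) (κ : ℝ), 0 ≤ Real.exp (-((p : ℝ) / P) ^ 2) := fun p κ => by positivity
  rw [swap3 (a := fun p κ => Real.exp (-((p : ℝ) / P) ^ 2) * (40 * (1 + |(p : ℝ)|)) *
      (|κ| ^ 2 * Real.exp (-(κ / K) ^ 2) +
        |(p : ℝ)| ^ 2 * (|κ| ^ 0 * Real.exp (-(κ / K) ^ 2))))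
    (b := fun r => (2 + 2 / x) * Real.exp (-(1 / 3) * |r|))]
  · rw [ofReal_neg, ← integral_complex_ofReal, ← MeasureTheory.integral_neg]
    congr 1
    ext r
    simp_rw [phase_eq]
    rw [← intervalIntegral.integral_ofReal, ← inner_eq hK hP]
    refine tsum_congr fun p => ?_
    rw [MeasureTheory.integral_mul_const, MeasureTheory.integral_const_mul,
      MeasureTheory.integral_add (intE hK 2 r) ((intE hK 0 r).const_mul _),
      MeasureTheory.integral_const_mul]
  · intro p
    have := gg_cont x φ p
    simp only [Function.uncurry_def]
    fun_prop
  · intro p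
    exact ((intG hK 2).add ((intG hK 0).const_mul _)).const_mul _
  · exact int_exp_abs.const_mul _
  · intro p κ r
    rw [norm_mul, norm_mul, norm_real, Real.norm_eq_abs, Real.abs_exp]
    have h1 := gg_bound hx φ p r
    have h2 : ‖((Real.exp (-(κ / K) ^ 2) : ℝ) : ℂ) *
        (κ : ℂ) ^ 2 * cexp (2 * I * (κ : ℂ) * (r : ℂ)) + ((p : ℝ) : ℂ) ^ 2 *
        (((Real.exp (-(κ / K) ^ 2) : ℝ) : ℂ) *
        (κ : ℂ) ^ 0 * cexp (2 * I * (κ : ℂ) * (r : ℂ)))‖ ≤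
        (|κ| ^ 2 * Real.exp (-(κ / K) ^ 2) +
        |(p : ℝ)| ^ 2 * (|κ| ^ 0 * Real.exp (-(κ / K) ^ 2))) := by
      refine (norm_add_le _ _).trans (le_of_eq ?_)
      simp only [norm_mul, normE, norm_pow, norm_real, Real.norm_eq_abs, Real.abs_exp]
      ring
    calc _ ≤ Real.exp (-((p : ℝ) / P) ^ 2) * (|κ| ^ 2 * Real.exp (-(κ / K) ^ 2) +
        |(p : ℝ)| ^ 2 * (|κ| ^ 0 * Real.exp (-(κ / K) ^ 2))) *
        (40 * (1 + |(p : ℝ)|) * ((2 + 2 / x) * Real.exp (-(1 / 3) * |r|))) := by gcongr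
      _ = _ := by ring
  · set m2 := ∫ κ : ℝ, |κ| ^ 2 * Real.exp (-(κ / K) ^ 2) with hm2
    set m0 := ∫ κ : ℝ, |κ| ^ 0 * Real.exp (-(κ / K) ^ 2) with hm0
    refine ((((sumG hP 0).mul_left (40 * m2)).add ((sumG hP 1).mul_left (40 * m2))).add
      (((sumG hP 2).mul_left (40 * m0)).add ((sumG hP 3).mul_left (40 * m0)))).congr fun p => ?_
    rw [MeasureTheory.integral_const_mul,
      MeasureTheory.integral_add (intG hK 2) ((intG hK 0).const_mul _),
      MeasureTheory.integral_const_mul, ← hm2, ← hm0]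
    ring
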